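/- A nontrivial pseudo BL-algebra A has every maximal filter normal if, and only if, A satisfies, for all n ≥ 1, all elements and all permutations π of {1, …, n}, the inequalities: (i) ((x₁·⋯·xₙ)⁻)² ≤ (x_{π(1)}²·⋯·x_{π(n)}²)⁻; (ii) (((x→y)ⁿ)⁻)² ≤ ((x⇝y)^{2n})⁻; (iii) (((x⇝y)ⁿ)⁻)² ≤ ((x→y)^{2n})⁻. -/

import Mathlib

/-- A pseudo BL-algebra: a bounded lattice `(A; ∨, ∧, 0, 1)` together with a monoid
structure `(A; ·, 1)` and two residua `→` (`himp`) and `⇝` (`rimp`) satisfying the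
residuation, divisibility and prelinearity conditions. -/
class PseudoBL (A : Type*) extends Lattice A, Monoid A, Zero A where
  himp : A → A → A
  rimp : A → A → A
  zero_le : ∀ x : A, (0 : A) ≤ x
  le_one : ∀ x : A, x ≤ 1
  mul_le_iff_himp : ∀ x y z : A, x * y ≤ z ↔ x ≤ himp y z
  mul_le_iff_rimp : ∀ x y z : A, x * y ≤ z ↔ y ≤ rimp x z
  himp_mul_inf : ∀ x y : A, himp x y * x = x ⊓ y
  mul_rimp_inf : ∀ x y : A, y * rimp y x = x ⊓ y
  prelin_himp : ∀ x y : A, himp x y ⊔ himp y x = 1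
  prelin_rimp : ∀ x y : A, rimp x y ⊔ rimp y x = 1

namespace PseudoBL

variable {A : Type*} [PseudoBL A]

/-- The left negation `x⁻ := x → 0`. -/
def lneg (x : A) : A := himp x 0

/-- A filter: a nonempty subset closed under `·` and upward closed. -/
def IsFilter (F : Set A) : Prop :=
  F.Nonempty ∧ (∀ x ∈ F, ∀ y ∈ F, x * y ∈ F) ∧ ∀ x ∈ F, ∀ y : A, x ≤ y → y ∈ F

/-- A maximal filter: a proper filter not properly contained in any proper filter. -/
def IsMaximalFilter (F : Set A) : Prop :=
  IsFilter F ∧ F ≠ Set.univ ∧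
    ∀ G : Set A, IsFilter G → G ≠ Set.univ → F ⊆ G → F = G

/-- A normal filter: `x→y ∈ F` iff `x⇝y ∈ F`. -/
def IsNormalFilter (F : Set A) : Prop :=
  ∀ x y : A, himp x y ∈ F ↔ rimp x y ∈ F

end PseudoBL

open PseudoBL

/-- Commutativity of an archimedean, divisible, totally preordered monoid. -/
theorem PBaux.comm {C : Type*} [Monoid C] [Preorder C] (z : C)
    (hl : ∀ a b c : C, a ≤ b → c * a ≤ c * b) (hr : ∀ a b c : C, a ≤ b → a * c ≤ b * c)
    (hz : ∀ x : C, z ≤ x) (h1 : ∀ x : C, x ≤ 1) (tot : ∀ a b : C, a ≤ b ∨ b ≤ a)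
    (hdiv : ∀ a b : C, a ≤ b → ∃ c, a ≤ b * c ∧ b * c ≤ a)
    (hres : ∀ a b : C, ∃ d, ∀ t, t * a ≤ b ↔ t ≤ d)
    (hnil : ∀ x : C, ¬ 1 ≤ x → ∃ n : ℕ, x ^ n ≤ z) (x y : C) : y * x ≤ x * y := by
  have hm : ∀ a b c d : C, a ≤ b → c ≤ d → a * c ≤ b * d := fun a b c d h h' =>
    (hr a b c h).trans (hl c d b h')
  by_contra hlt
  obtain ⟨d, hd⟩ := hres (y * x) (x * y)
  have hs : ¬ y * x ≤ z := fun h => hlt (h.trans (hz _))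
  have hx : ¬ x ≤ z := fun h => hs ((hm _ _ _ _ (h1 y) le_rfl).trans (by simpa using h))
  have hy : ¬ y ≤ z := fun h => hs ((hm _ _ _ _ le_rfl (h1 x)).trans (by simpa using h))
  have hz1 : ¬ (1 : C) ≤ z := fun h => hs ((h1 _).trans h)
  have hd1 : ¬ 1 ≤ d := fun h => hlt (by simpa using (hd 1).2 h)
  -- bracketing between consecutive powers
  have brack : ∀ f u : C, ¬ 1 ≤ f → ¬ u ≤ z → ∃ k : ℕ, u ≤ f ^ k ∧ ¬ u ≤ f ^ (k+1) := by
    intro f u hf hu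
    by_contra hcon
    push Not at hcon
    have : ∀ k : ℕ, u ≤ f ^ k := by
      intro k
      induction k with
      | zero => simpa using h1 u
      | succ k ih => exact hcon k ih
    obtain ⟨n, hn⟩ := hnil f hf
    exact hu ((this n).trans hn)
  have hs1 : ¬ 1 ≤ y * x := by
    intro h
    have hx1 : 1 ≤ x := h.trans (by simpa using hm _ _ _ _ (h1 y) (le_refl x))
    have hy1 : 1 ≤ y := h.trans (by simpa using hm _ _ _ _ (le_refl y) (h1 x))
    exact hlt ((h1 _).trans (by simpa using hm _ _ _ _ hx1 hy1))
  have hdz : ¬ d ≤ z := by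
    intro h
    obtain ⟨n, hn⟩ := hnil _ hs1
    induction n with
    | zero => exact hz1 (by simpa using hn)
    | succ k ih =>
      rw [pow_succ] at hn
      exact ih (((hd _).1 (hn.trans (hz _))).trans h)
  by_cases hco : ∃ c : C, ¬ 1 ≤ c ∧ ∀ f, ¬ 1 ≤ f → f ≤ c
  · obtain ⟨c, hc1, hc⟩ := hco
    have key : ∀ u : C, ¬ u ≤ z → ∃ k : ℕ, u ≤ c ^ k ∧ c ^ k ≤ u := by
      intro u hu
      obtain ⟨k, hk, hk'⟩ := brack c u hc1 hu
      refine ⟨k, hk, ?_⟩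
      obtain ⟨e, he, he'⟩ := hdiv _ _ hk
      by_cases h : 1 ≤ e
      · exact le_trans (by simpa using hl _ _ (c ^ k) h) he'
      · exact absurd (he.trans (by rw [pow_succ]; exact hl _ _ _ (hc e h))) hk'
    obtain ⟨k, hk, hk'⟩ := key x hx
    obtain ⟨m, hm1, hm'⟩ := key y hy
    apply hlt
    calc y * x ≤ c ^ m * c ^ k := hm _ _ _ _ hm1 hk
      _ = c ^ k * c ^ m := by rw [← pow_add, ← pow_add, add_comm]
      _ ≤ x * y := hm _ _ _ _ hk' hm'
  · push Not at hco
    obtain ⟨d', hd'1, hd'⟩ := hco d hd1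
    have hdd : d ≤ d' := (tot d d').resolve_right hd'
    obtain ⟨c, hc, hc'⟩ := hdiv _ _ hdd
    have hc1 : ¬ 1 ≤ c := fun h => hd' (le_trans (by simpa using hl _ _ d' h) hc')
    obtain ⟨e, he1, hed⟩ : ∃ e, ¬ 1 ≤ e ∧ d ≤ e * e := by
      rcases tot d' c with h | h
      · exact ⟨c, hc1, hc.trans (hr _ _ _ h)⟩
      · exact ⟨d', hd'1, hc.trans (hl _ _ _ h)⟩
    obtain ⟨f, hf1, hf⟩ := hco e he1
    have hef : e ≤ f := (tot e f).resolve_right hf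
    have hff : ¬ f * f ≤ d := by
      intro h
      obtain ⟨g, hg, hg'⟩ := hdiv _ _ hef
      have hg1 : ¬ 1 ≤ g := fun h => hf (le_trans (by simpa using hl _ _ f h) hg')
      have h2 : f * f ≤ f * f * g := by
        calc f * f ≤ d := h
          _ ≤ e * e := hed
          _ ≤ f * e := hr _ _ _ hef
          _ ≤ f * (f * g) := hl _ _ _ hg
          _ = f * f * g := (mul_assoc _ _ _).symm
      have h3 : ∀ n : ℕ, f * f ≤ f * f * g ^ n := by
        intro n
        induction n with
        | zero => simp
        | succ n ih =>
          rw [pow_succ, ← mul_assoc]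
          exact h2.trans (hr _ _ _ ih)
      obtain ⟨n, hn⟩ := hnil g hg1
      apply hdz
      calc d ≤ e * e := hed
        _ ≤ f * f := hm _ _ _ _ hef hef
        _ ≤ f * f * g ^ n := h3 n
        _ ≤ 1 * z := hm _ _ _ _ (h1 _) hn
        _ = z := one_mul z
    apply hff
    rw [← hd]
    obtain ⟨k, hk, hk'⟩ := brack f x hf1 hx
    obtain ⟨m, hm1, hm'⟩ := brack f y hf1 hy
    calc f * f * (y * x) ≤ f * f * (f ^ m * f ^ k) := hl _ _ _ (hm _ _ _ _ hm1 hk)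
      _ = f ^ (k+1) * f ^ (m+1) := by
        rw [← pow_two, ← pow_add, ← pow_add, ← pow_add]; congr 1; omega
      _ ≤ x * y := hm _ _ _ _ ((tot _ _).resolve_left hk') ((tot _ _).resolve_left hm')

namespace PseudoBL

section basics
variable {A : Type*} [PseudoBL A]

theorem mul_mono {a b c d : A} (h : a ≤ b) (h' : c ≤ d) : a * c ≤ b * d := by
  have h2 : b * c ≤ b * d := by
    rw [mul_le_iff_rimp]; exact h'.trans ((mul_le_iff_rimp _ _ _).1 le_rfl)
  have h1 : a * c ≤ b * c := by
    rw [mul_le_iff_himp]; exact h.trans ((mul_le_iff_himp _ _ _).1 le_rfl)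
  exact h1.trans h2

theorem himp_mul_le (a b : A) : himp a b * a ≤ b := by
  rw [himp_mul_inf]; exact inf_le_right

theorem mul_rimp_le (a b : A) : a * rimp a b ≤ b := by
  rw [mul_rimp_inf]; exact inf_le_left

theorem mul_le_r (a b : A) : a * b ≤ b := by
  simpa using mul_mono (le_one a) (le_refl b)

theorem mul_le_l (a b : A) : a * b ≤ a := by
  simpa using mul_mono (le_refl a) (le_one b)

theorem himp_mul (a b c : A) : himp (a * b) c = himp a (himp b c) := by
  apply le_antisymm
  · rw [← mul_le_iff_himp, ← mul_le_iff_himp, mul_assoc, mul_le_iff_himp]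
  · rw [← mul_le_iff_himp, ← mul_assoc, mul_le_iff_himp, mul_le_iff_himp]

theorem rimp_mul (a b c : A) : rimp (b * a) c = rimp a (rimp b c) := by
  apply le_antisymm
  · rw [← mul_le_iff_rimp, ← mul_le_iff_rimp, ← mul_assoc, mul_le_iff_rimp]
  · rw [← mul_le_iff_rimp, mul_assoc, mul_le_iff_rimp, mul_le_iff_rimp]

theorem himp_one (a : A) : himp 1 a = a := by
  have := himp_mul_inf (1 : A) a
  rw [mul_one] at this
  rw [this]; exact inf_eq_right.2 (le_one a)

theorem eq_one_iff_le (a b : A) : himp a b = 1 ↔ a ≤ b := by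
  constructor
  · intro h
    have := himp_mul_le a b
    rwa [h, one_mul] at this
  · intro h
    apply le_antisymm (le_one _)
    rw [← mul_le_iff_himp, one_mul]; exact h

theorem sup_mul_le {a b c d : A} (h : a * c ≤ d) (h' : b * c ≤ d) : (a ⊔ b) * c ≤ d := by
  rw [mul_le_iff_himp] at *; exact sup_le h h'

theorem mul_sup_le {a b c d : A} (h : c * a ≤ d) (h' : c * b ≤ d) : c * (a ⊔ b) ≤ d := by
  rw [mul_le_iff_rimp] at *; exact sup_le h h'

theorem sup_mul_one {u v v' : A} (h : u ⊔ v = 1) (h' : u ⊔ v' = 1) : u ⊔ v * v' = 1 := by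
  apply le_antisymm (le_one _)
  have : (u ⊔ v) * (u ⊔ v') ≤ u ⊔ v * v' := by
    apply sup_mul_le
    · exact (mul_le_l _ _).trans le_sup_left
    · apply mul_sup_le
      · exact (mul_le_r _ _).trans le_sup_left
      · exact le_sup_right
  rwa [h, h', one_mul] at this

theorem sup_pow_one {u v : A} (h : u ⊔ v = 1) (n : ℕ) : u ⊔ v ^ n = 1 := by
  induction n with
  | zero => rw [pow_zero]; exact sup_eq_right.2 (le_one _)
  | succ n ih => rw [pow_succ]; exact sup_mul_one ih h

theorem IsFilter.one_mem {F : Set A} (h : IsFilter F) : (1 : A) ∈ F := by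
  obtain ⟨⟨x, hx⟩, _, h2⟩ := h
  exact h2 x hx 1 (le_one x)

theorem IsFilter.zero_notMem {F : Set A} (h : IsFilter F) (hp : F ≠ Set.univ) : (0 : A) ∉ F := by
  intro h0
  exact hp (Set.eq_univ_of_forall fun x => h.2.2 0 h0 x (zero_le x))

theorem IsFilter.pow_mem {F : Set A} (h : IsFilter F) {a : A} (ha : a ∈ F) (n : ℕ) :
    a ^ n ∈ F := by
  induction n with
  | zero => simpa using h.one_mem
  | succ n ih => rw [pow_succ]; exact h.2.1 _ ih _ ha

theorem IsFilter.prod_mem {F : Set A} (h : IsFilter F) (l : List A) (hl : ∀ t ∈ l, t ∈ F) :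
    l.prod ∈ F := by
  induction l with
  | nil => simpa using h.one_mem
  | cons a l ih =>
    rw [List.prod_cons]
    exact h.2.1 _ (hl a (by simp)) _ (ih fun t ht => hl t (by simp [ht]))

theorem exists_max {S : Set A} (hS : IsFilter S) (h0 : (0 : A) ∉ S) :
    ∃ M, IsMaximalFilter M ∧ S ⊆ M := by
  obtain ⟨M, hSM, hM⟩ := zorn_subset_nonempty {F : Set A | IsFilter F ∧ (0 : A) ∉ F}
    (by
      intro c hc hch hne
      refine ⟨⋃₀ c, ⟨⟨?_, ?_, ?_⟩, ?_⟩, fun s hs => Set.subset_sUnion_of_mem hs⟩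
      · obtain ⟨s, hs⟩ := hne
        exact ⟨1, s, hs, (hc hs).1.one_mem⟩
      · rintro x ⟨s, hs, hx⟩ y ⟨t, ht, hy⟩
        rcases hch.total hs ht with h | h
        · exact ⟨t, ht, (hc ht).1.2.1 _ (h hx) _ hy⟩
        · exact ⟨s, hs, (hc hs).1.2.1 _ hx _ (h hy)⟩
      · rintro x ⟨s, hs, hx⟩ y hxy
        exact ⟨s, hs, (hc hs).1.2.2 _ hx _ hxy⟩
      · rintro ⟨s, hs, hx⟩
        exact (hc hs).2 hx) S ⟨hS, h0⟩
  refine ⟨M, ⟨hM.prop.1, ?_, ?_⟩, hSM⟩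
  · intro h
    exact hM.prop.2 (h ▸ Set.mem_univ _)
  · intro G hG hGp hMG
    exact hM.eq_of_subset ⟨hG, hG.zero_notMem hGp⟩ hMG

end basics

section quot
variable {A : Type*} [PseudoBL A] {M : Set A}

theorem q_of_le (hM : IsFilter M) {a b : A} (h : a ≤ b) : himp a b ∈ M := by
  rw [(eq_one_iff_le a b).2 h]; exact hM.one_mem

theorem q_trans (hM : IsFilter M) {a b c : A} (h : himp a b ∈ M) (h' : himp b c ∈ M) :
    himp a c ∈ M := by
  refine hM.2.2 _ (hM.2.1 _ h' _ h) _ ?_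
  rw [← mul_le_iff_himp, mul_assoc]
  exact (mul_mono le_rfl (himp_mul_le a b)).trans (himp_mul_le b c)

theorem q_mul_r (hM : IsFilter M) {a b : A} (c : A) (h : himp a b ∈ M) :
    himp (a * c) (b * c) ∈ M := by
  refine hM.2.2 _ h _ ?_
  rw [← mul_le_iff_himp, ← mul_assoc]
  exact mul_mono (himp_mul_le a b) le_rfl

theorem q_mul_l (hM : IsFilter M) (hN : IsNormalFilter M) {a b : A} (c : A)
    (h : himp a b ∈ M) : himp (c * a) (c * b) ∈ M := by
  rw [hN] at h ⊢
  refine hM.2.2 _ h _ ?_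
  rw [← mul_le_iff_rimp, mul_assoc]
  exact mul_mono le_rfl (mul_rimp_le a b)

theorem q_mul (hM : IsFilter M) (hN : IsNormalFilter M) {a b c d : A}
    (h : himp a b ∈ M) (h' : himp c d ∈ M) : himp (a * c) (b * d) ∈ M :=
  q_trans hM (q_mul_r hM c h) (q_mul_l hM hN b h')

theorem q_mem (hM : IsFilter M) {a b : A} (h : himp a b ∈ M) (ha : a ∈ M) : b ∈ M :=
  hM.2.2 _ (hM.2.1 _ h _ ha) _ (himp_mul_le a b)

theorem q_nil (hM : IsMaximalFilter M) (hN : IsNormalFilter M) {u : A} (hu : u ∉ M) :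
    ∃ n : ℕ, himp (u ^ n) 0 ∈ M := by
  by_contra hcon
  push Not at hcon
  have hF := hM.1
  have := hM.2.2 {z | ∃ n : ℕ, himp (u ^ n) z ∈ M} ⟨⟨1, 0, q_of_le hF (le_one _)⟩, ?_, ?_⟩ ?_ ?_
  · apply hu
    rw [this]
    exact ⟨1, q_of_le hF (by simp)⟩
  · rintro x ⟨n, hn⟩ y ⟨m, hm⟩
    refine ⟨n + m, ?_⟩
    rw [pow_add]
    exact q_mul hF hN hn hm
  · rintro x ⟨n, hn⟩ y hxy
    exact ⟨n, q_trans hF hn (q_of_le hF hxy)⟩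
  · intro h
    have : (0 : A) ∈ {z | ∃ n : ℕ, himp (u ^ n) z ∈ M} := h ▸ Set.mem_univ _
    obtain ⟨n, hn⟩ := this
    exact hcon n hn
  · intro x hx
    exact ⟨0, by rwa [pow_zero, himp_one]⟩

theorem q_tot (hM : IsMaximalFilter M) (hN : IsNormalFilter M) (a b : A) :
    himp a b ∈ M ∨ himp b a ∈ M := by
  by_contra hcon
  push Not at hcon
  obtain ⟨n, hn⟩ := q_nil hM hN hcon.1
  obtain ⟨m, hm⟩ := q_nil hM hN hcon.2
  have h := sup_pow_one (prelin_himp a b) m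
  rw [sup_comm] at h
  have h := sup_pow_one h n
  apply hM.1.zero_notMem hM.2.1
  refine hM.1.2.2 _ (hM.1.2.1 _ hn _ hm) _ ?_
  rw [← mul_one (_ * _), ← h]
  apply mul_sup_le
  · rw [mul_le_iff_himp]; exact mul_le_r _ _
  · rw [mul_le_iff_himp]; exact mul_le_l _ _

theorem q_div (hF : IsFilter M) {a b : A} (h : himp a b ∈ M) : himp a (b * rimp b a) ∈ M := by
  refine hF.2.2 _ h _ ?_
  rw [← mul_le_iff_himp, himp_mul_inf, mul_rimp_inf]

theorem q_comm (hM : IsMaximalFilter M) (hN : IsNormalFilter M) (x y : A) :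
    himp (y * x) (x * y) ∈ M := by
  have hF := hM.1
  let P : Preorder A :=
    { le := fun a b => himp a b ∈ M
      lt := fun a b => himp a b ∈ M ∧ ¬ himp b a ∈ M
      le_refl := fun a => q_of_le hF le_rfl
      le_trans := fun a b c h h' => q_trans hF h h'
      lt_iff_le_not_ge := fun a b => Iff.rfl }
  refine @PBaux.comm A _ P 0 ?_ ?_ ?_ ?_ ?_ ?_ ?_ ?_ x y
  · intro a b c h
    exact q_mul_l hF hN c h
  · intro a b c h
    exact q_mul_r hF c h
  · intro a
    exact q_of_le hF (zero_le a)
  · intro a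
    exact q_of_le hF (le_one a)
  · exact q_tot hM hN
  · intro a b h
    refine ⟨rimp b a, ?_, ?_⟩
    · exact q_div hF h
    · exact q_of_le hF (mul_rimp_le b a)
  · intro a b
    refine ⟨himp a b, fun t => ?_⟩
    change himp (t * a) b ∈ M ↔ himp t (himp a b) ∈ M
    rw [himp_mul]
  · intro u hu
    apply q_nil hM hN
    intro h
    apply hu
    change himp 1 u ∈ M
    rwa [himp_one]

theorem q_rimp_iff (hN : IsNormalFilter M) (a b c : A) :
    himp a (rimp b c) ∈ M ↔ himp (b * a) c ∈ M := by
  rw [hN, hN, rimp_mul]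

theorem q_himp_rimp (hM : IsMaximalFilter M) (hN : IsNormalFilter M) (x y : A) :
    himp (himp x y) (rimp x y) ∈ M := by
  rw [q_rimp_iff hN]
  exact q_trans hM.1 (q_comm hM hN _ _) (q_of_le hM.1 (himp_mul_le _ _))

theorem q_rimp_himp (hM : IsMaximalFilter M) (hN : IsNormalFilter M) (x y : A) :
    himp (rimp x y) (himp x y) ∈ M := by
  rw [← himp_mul]
  exact q_trans hM.1 (q_comm hM hN _ _) (q_of_le hM.1 (mul_rimp_le _ _))

theorem q_pow (hM : IsMaximalFilter M) (hN : IsNormalFilter M) {a b : A} (h : himp a b ∈ M)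
    (n : ℕ) : himp (a ^ n) (b ^ n) ∈ M := by
  induction n with
  | zero => simpa using q_of_le hM.1 (le_refl (1 : A))
  | succ n ih => rw [pow_succ, pow_succ]; exact q_mul hM.1 hN ih h

theorem q_perm (hM : IsMaximalFilter M) (hN : IsNormalFilter M) {l l' : List A}
    (h : l.Perm l') : himp l.prod l'.prod ∈ M := by
  induction h with
  | nil => exact q_of_le hM.1 le_rfl
  | cons a _ ih => rw [List.prod_cons, List.prod_cons]; exact q_mul_l hM.1 hN _ ih
  | swap a b l =>
    simp only [List.prod_cons, ← mul_assoc]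
    exact q_mul_r hM.1 _ (q_comm hM hN _ _)
  | trans _ _ ih ih' => exact q_trans hM.1 ih ih'

theorem q_dneg (hM : IsMaximalFilter M) (hN : IsNormalFilter M) {b : A}
    (h : himp (himp b 0) 0 ∈ M) : b ∈ M := by
  by_contra hb
  obtain ⟨n, hn⟩ := q_nil hM hN hb
  induction n with
  | zero =>
    rw [pow_zero, himp_one] at hn
    exact hM.1.zero_notMem hM.2.1 hn
  | succ k ih =>
    rw [pow_succ, himp_mul] at hn
    exact ih (q_trans hM.1 hn h)

theorem slack_list (hM : IsMaximalFilter M) (hN : IsNormalFilter M) (w : A)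
    (V1 : ∀ a b : A, w = a * b → himp a 0 ∈ M → b ∈ M) (l : List A) :
    ∀ a : A, w = a * (l.map (fun t => t ^ 2)).prod → himp (a * l.prod) 0 ∈ M →
      himp a 0 ∈ M := by
  have hF := hM.1
  have up : ∀ a b : A, a ≤ b → a ∈ M → b ∈ M := fun a b h ha => hF.2.2 _ ha _ h
  induction l with
  | nil => intro a _ h; simpa using h
  | cons t l ih =>
    intro a hw h
    simp only [List.map_cons, List.prod_cons] at hw h
    have h2 : himp (a * t ^ 2) 0 ∈ M := by
      apply ih
      · rw [hw, mul_assoc]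
      · refine q_trans hF (q_of_le hF ?_) h
        rw [mul_assoc, pow_two]
        apply mul_mono le_rfl
        rw [mul_assoc]
        exact mul_le_r _ _
    have h3 : (l.map (fun t => t ^ 2)).prod ∈ M := V1 (a * t ^ 2) _ (by rw [hw, mul_assoc]) h2
    have h4 : l.prod ∈ M := by
      refine up _ _ ?_ h3
      clear * -
      induction l with
      | nil => simp
      | cons s l ih =>
        simp only [List.map_cons, List.prod_cons]
        exact mul_mono (by rw [pow_two]; exact mul_le_l _ _) ih
    have h5 : himp (a * t) 0 ∈ M := by
      rw [← mul_assoc] at h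
      refine q_trans hF ?_ h
      have := q_mul_l hF hN (a * t) (a := 1) (b := l.prod) (by rwa [himp_one])
      rwa [mul_one] at this
    have h6 : t * (l.map (fun t => t ^ 2)).prod ∈ M :=
      V1 (a * t) _ (by rw [hw, pow_two]; simp only [mul_assoc]) h5
    have h7 : t ∈ M := up _ _ (mul_le_l _ _) h6
    refine q_trans hF ?_ h5
    have := q_mul_l hF hN a (a := 1) (b := t) (by rwa [himp_one])
    rwa [mul_one] at this

end quot

section main
variable {A : Type*} [PseudoBL A]

theorem sq_prod_le (l : List A) : (l.map (fun t => t ^ 2)).prod ≤ l.prod := by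
  induction l with
  | nil => simp
  | cons s l ih =>
    simp only [List.map_cons, List.prod_cons]
    exact mul_mono (by rw [pow_two]; exact mul_le_l _ _) ih

theorem general (hA : ∀ F : Set A, IsMaximalFilter F → IsNormalFilter F) (p : A) (l : List A)
    (h : ∀ M : Set A, IsMaximalFilter M → IsNormalFilter M → himp l.prod p ∈ M) :
    lneg p ^ 2 ≤ lneg (l.map (fun t => t ^ 2)).prod := by
  unfold lneg
  rw [← mul_le_iff_himp]
  set w := himp p 0 ^ 2 * (l.map (fun t => t ^ 2)).prod with hw
  rw [← eq_one_iff_le]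
  by_contra hu
  obtain ⟨M, hM, hSM⟩ := exists_max (S := {v : A | himp w 0 ⊔ v = 1})
    ⟨⟨1, sup_eq_right.2 (le_one _)⟩, fun x hx y hy => sup_mul_one hx hy, fun x hx y hxy =>
      le_antisymm (le_one _) (le_trans (le_of_eq hx.symm) (sup_le_sup_left hxy _))⟩
    (by
      intro h0
      apply hu
      have h0 : himp w 0 ⊔ 0 = 1 := h0
      rwa [sup_eq_left.2 (zero_le _)] at h0)
  have hN := hA M hM
  have hF := hM.1
  have V : ∀ a b : A, w = a * b → himp (himp b 0) a ∈ M := by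
    intro a b hab
    apply hSM
    change himp w 0 ⊔ _ = 1
    rw [hab, himp_mul]
    exact prelin_himp _ _
  have V1 : ∀ a b : A, w = a * b → himp a 0 ∈ M → b ∈ M := fun a b hab ha =>
    q_dneg hM hN (q_trans hF (V a b hab) ha)
  have V2 : ∀ a b : A, w = a * b → himp b 0 ∈ M → a ∈ M := fun a b hab hb =>
    q_mem hF (V a b hab) hb
  have hlp := h M hM hN
  have hp : himp p 0 ∈ M := by
    apply V2 (himp p 0) (himp p 0 * (l.map (fun t => t ^ 2)).prod)
    · rw [hw, pow_two, mul_assoc]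
    · refine q_trans hF (q_mul_l hF hN _ (q_trans hF (q_of_le hF (sq_prod_le l)) hlp)) ?_
      exact q_of_le hF (himp_mul_le _ _)
  have h0 := slack_list hM hN w V1 l (himp p 0 ^ 2) hw
    (q_trans hF (q_of_le hF (mul_le_r _ _)) (q_trans hF hlp hp))
  exact hF.zero_notMem hM.2.1 (q_mem hF h0 (hF.pow_mem hp 2))

theorem perm_map {α β : Type*} (f : α → β) {l l' : List β} (h : l.Perm l') :
    ∀ s : List α, l = s.map f → ∃ s', s.Perm s' ∧ l' = s'.map f := by
  induction h with
  | nil => intro s hs; exact ⟨s, .refl _, hs⟩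
  | cons a _ ih =>
    intro s hs
    rcases s with _ | ⟨c, s⟩
    · simp at hs
    · simp only [List.map_cons, List.cons.injEq] at hs
      obtain ⟨s', h1, h2⟩ := ih s hs.2
      exact ⟨c :: s', h1.cons c, by rw [List.map_cons, hs.1, h2]⟩
  | swap a b l =>
    intro s hs
    rcases s with _ | ⟨c, _ | ⟨d, s⟩⟩
    · simp at hs
    · simp at hs
    · simp only [List.map_cons, List.cons.injEq] at hs
      exact ⟨d :: c :: s, List.Perm.swap _ _ _, by simp [hs.1, hs.2.1, hs.2.2]⟩
  | trans _ _ ih ih' =>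
    intro s hs
    obtain ⟨s', h1, h2⟩ := ih s hs
    obtain ⟨s'', h3, h4⟩ := ih' s' h2
    exact ⟨s'', h1.trans h3, h4⟩

theorem perm_exists {l l' : List A} (h : l.Perm l') :
    ∃ π : Equiv.Perm (Fin l.length), List.ofFn (fun i => l.get (π i)) = l' := by
  obtain ⟨s, hs, rfl⟩ := perm_map l.get h (List.finRange l.length)
    (by rw [← List.ofFn_eq_map, List.ofFn_get])
  have hlen : l.length = s.length := by simpa using hs.length_eq
  have hnd : s.Nodup := hs.nodup_iff.1 (List.nodup_finRange _)
  have hinj : Function.Injective (fun i : Fin l.length => s.get (Fin.cast hlen i)) :=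
    (List.nodup_iff_injective_get.1 hnd).comp (Fin.cast_injective hlen)
  refine ⟨Equiv.ofBijective _ (Finite.injective_iff_bijective.1 hinj), ?_⟩
  apply List.ext_getElem
  · simp [hlen]
  · intro i h1 h2
    simp

theorem backward (hnt : (0 : A) ≠ 1)
    (h1 : ∀ (n : ℕ), 1 ≤ n → ∀ (x : Fin n → A) (π : Equiv.Perm (Fin n)),
        lneg (List.ofFn x).prod ^ 2 ≤ lneg (List.ofFn (fun i => x (π i) ^ 2)).prod)
    {F : Set A} (hF : IsMaximalFilter F) {a b : A}
    (hab : ∀ n : ℕ, 1 ≤ n → lneg (b ^ n) ^ 2 ≤ lneg (a ^ (2 * n))) (ha : a ∈ F) : b ∈ F := by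
  classical
  by_contra hb
  have h0 : ∃ L : List A, (∀ t ∈ L, t ∈ F ∨ t = b) ∧ L.prod ≤ 0 := by
    by_contra hcon
    have := hF.2.2 {z | ∃ L : List A, (∀ t ∈ L, t ∈ F ∨ t = b) ∧ L.prod ≤ z}
      ⟨⟨1, [], by simp⟩, ?_, ?_⟩ ?_ ?_
    · apply hb
      rw [this]
      exact ⟨[b], by simp⟩
    · rintro x ⟨L, hL, hx⟩ y ⟨L', hL', hy⟩
      refine ⟨L ++ L', ?_, ?_⟩
      · intro t ht
        rcases List.mem_append.1 ht with h | h
        · exact hL t h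
        · exact hL' t h
      · rw [List.prod_append]; exact mul_mono hx hy
    · rintro x ⟨L, hL, hx⟩ y hxy
      exact ⟨L, hL, hx.trans hxy⟩
    · intro h
      have h' : (0 : A) ∈ {z | ∃ L : List A, (∀ t ∈ L, t ∈ F ∨ t = b) ∧ L.prod ≤ z} :=
        h ▸ Set.mem_univ _
      exact hcon h'
    · intro x hx
      exact ⟨[x], by simp [hx]⟩
  obtain ⟨L, hL, hL0⟩ := h0
  have hperm := (List.filter_append_perm (fun t => decide (t ∈ F)) L).symm
  obtain ⟨π, hπ⟩ := perm_exists hperm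
  have hlen : 1 ≤ L.length := by
    rcases L with _ | ⟨s, L⟩
    · exact absurd (le_antisymm (zero_le _) (by simpa using hL0)) hnt
    · simp
  have h2 := h1 L.length hlen L.get π
  have e1 : lneg (List.ofFn L.get).prod = 1 := by
    rw [List.ofFn_get]; exact (eq_one_iff_le _ _).2 hL0
  have e2 : List.ofFn (fun i => L.get (π i) ^ 2) =
      (List.ofFn (fun i => L.get (π i))).map (fun t => t ^ 2) := by
    rw [List.map_ofFn]; rfl
  rw [e1, one_pow, e2, hπ, List.map_append, List.prod_append] at h2
  have h3 := (eq_one_iff_le _ _).1 (le_antisymm (le_one _) h2)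
  set g := (List.map (fun t => t ^ 2) (List.filter (fun t => decide (t ∈ F)) L)).prod with hg
  have hgF : g ∈ F := by
    apply hF.1.prod_mem
    intro t ht
    simp only [List.mem_map, List.mem_filter, decide_eq_true_eq] at ht
    obtain ⟨s, ⟨_, hs⟩, rfl⟩ := ht
    exact hF.1.pow_mem hs 2
  obtain ⟨m, hm⟩ : ∃ m : ℕ, List.filter (fun t => !decide (t ∈ F)) L = List.replicate m b := by
    refine ⟨_, List.eq_replicate_of_mem ?_⟩
    intro t ht
    simp only [List.mem_filter, Bool.not_eq_true', decide_eq_false_iff_not] at ht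
    exact (hL t ht.1).resolve_left ht.2
  rw [hm, List.map_replicate, List.prod_replicate, ← pow_mul] at h3
  have h4 : g * b ^ (2 * m + 1) ≤ 0 := by
    refine le_trans ?_ h3
    rw [pow_succ]
    exact mul_mono le_rfl (mul_le_l _ _)
  have h5 : g ≤ lneg (b ^ (2 * m + 1)) := (mul_le_iff_himp _ _ _).1 h4
  have h6 := hab (2 * m + 1) (by omega)
  have h7 : g ^ 2 ≤ lneg (a ^ (2 * (2 * m + 1))) := by
    refine le_trans ?_ h6
    rw [pow_two, pow_two]; exact mul_mono h5 h5
  have h8 : g ^ 2 * a ^ (2 * (2 * m + 1)) ≤ 0 := (mul_le_iff_himp _ _ _).2 h7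
  exact hF.1.zero_notMem hF.2.1 (hF.1.2.2 _ (hF.1.2.1 _ (hF.1.pow_mem hgF 2) _
    (hF.1.pow_mem ha _)) _ h8)

end main

end PseudoBL

/-- A nontrivial pseudo BL-algebra has every maximal filter normal iff
it satisfies inequalities (i)-(iii). -/
theorem stmt_5 {A : Type*} [PseudoBL A] (hnt : (0 : A) ≠ 1) :
    (∀ F : Set A, IsMaximalFilter F → IsNormalFilter F) ↔
      ((∀ (n : ℕ), 1 ≤ n → ∀ (x : Fin n → A) (π : Equiv.Perm (Fin n)),
        lneg (List.ofFn x).prod ^ 2 ≤ lneg (List.ofFn (fun i => x (π i) ^ 2)).prod) ∧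
      (∀ (n : ℕ), 1 ≤ n → ∀ x y : A,
        lneg (PseudoBL.himp x y ^ n) ^ 2 ≤ lneg (PseudoBL.rimp x y ^ (2 * n))) ∧
      (∀ (n : ℕ), 1 ≤ n → ∀ x y : A,
        lneg (PseudoBL.rimp x y ^ n) ^ 2 ≤ lneg (PseudoBL.himp x y ^ (2 * n)))) := by
  constructor
  · intro hA
    refine ⟨?_, ?_, ?_⟩
    · intro n _ x π
      have := PseudoBL.general hA (List.ofFn x).prod (List.ofFn (fun i => x (π i)))
        (fun M hM hN => PseudoBL.q_perm hM hN (Equiv.Perm.ofFn_comp_perm π x))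
      rw [List.map_ofFn] at this
      exact this
    · intro n _ x y
      have := PseudoBL.general hA (PseudoBL.himp x y ^ n) (List.replicate n (PseudoBL.rimp x y))
        (fun M hM hN => by
          rw [List.prod_replicate]
          exact PseudoBL.q_pow hM hN (PseudoBL.q_rimp_himp hM hN x y) n)
      rwa [List.map_replicate, List.prod_replicate, ← pow_mul] at this
    · intro n _ x y
      have := PseudoBL.general hA (PseudoBL.rimp x y ^ n) (List.replicate n (PseudoBL.himp x y))
        (fun M hM hN => by
          rw [List.prod_replicate]
          exact PseudoBL.q_pow hM hN (PseudoBL.q_himp_rimp hM hN x y) n)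
      rwa [List.map_replicate, List.prod_replicate, ← pow_mul] at this
  · rintro ⟨h1, h2, h3⟩ F hF x y
    exact ⟨PseudoBL.backward hnt h1 hF (fun n hn => h3 n hn x y),
      PseudoBL.backward hnt h1 hF (fun n hn => h2 n hn x y)⟩
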